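/- arXiv:1003.1224 — 2 statements merged into one kernel-verified Lean document; each statement's English description precedes it below -/
import Mathlib

section
/- Let u be a uniformly recurrent infinite word over a finite alphabet. Then u is rich in palindromes if and only if P(n+1) + P(n) = C(n+1) − C(n) + 2 for all n ∈ ℕ. -/
open List

/-- The factor of `u` of length `n` starting at position `i`. -/
def word {A : Type*} (u : ℕ → A) (i n : ℕ) : List A :=
  (List.range n).map (fun j => u (i + j))

/-- `w` occurs in `u` at position `i`. -/
def OccursAt {A : Type*} (u : ℕ → A) (w : List A) (i : ℕ) : Prop :=
  w = word u i w.length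

/-- `w` is a factor of the infinite word `u`. -/
def IsFactor {A : Type*} (u : ℕ → A) (w : List A) : Prop :=
  ∃ i, OccursAt u w i

/-- Every letter of the alphabet occurs in `u`. -/
def AllLettersOccur {A : Type*} (u : ℕ → A) : Prop :=
  ∀ a : A, ∃ i, u i = a

/-- The language of `u` is closed under reversal. -/
def ClosedUnderReversal {A : Type*} (u : ℕ → A) : Prop :=
  ∀ w : List A, IsFactor u w → IsFactor u w.reverse

/-- `u` is uniformly recurrent: every factor occurs in every window of some
bounded length. -/
def UniformlyRecurrent {A : Type*} (u : ℕ → A) : Prop :=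
  ∀ w : List A, IsFactor u w → ∃ N : ℕ, ∀ i : ℕ, ∃ j : ℕ,
    i ≤ j ∧ j < i + N ∧ OccursAt u w j

/-- Factor complexity: the number of factors of `u` of length `n`. -/
noncomputable def complexity {A : Type*} (u : ℕ → A) (n : ℕ) : ℕ :=
  Set.ncard {w : List A | w.length = n ∧ IsFactor u w}

/-- Palindromic complexity: the number of palindromic factors of `u` of
length `n`. -/
noncomputable def palComplexity {A : Type*} (u : ℕ → A) (n : ℕ) : ℕ :=
  Set.ncard {w : List A | w.length = n ∧ IsFactor u w ∧ w.reverse = w}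

/-- The number of distinct palindromic factors of a finite word
(the empty word included). -/
noncomputable def palCount {A : Type*} (w : List A) : ℕ :=
  Set.ncard {v : List A | v <:+: w ∧ v.reverse = v}

/-- `u` is rich in palindromes. -/
def Rich {A : Type*} (u : ℕ → A) : Prop :=
  ∀ w : List A, IsFactor u w → palCount w = w.length + 1

/-- `j < k` are two successive occurrences of `w` in `u`. -/
def SuccOccurrences {A : Type*} (u : ℕ → A) (w : List A) (j k : ℕ) : Prop :=
  OccursAt u w j ∧ OccursAt u w k ∧ j < k ∧
    ∀ l : ℕ, j < l → l < k → ¬ OccursAt u w l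

/-- The set of return words of the factor `w` in `u`. -/
def returnWords {A : Type*} (u : ℕ → A) (w : List A) : Set (List A) :=
  {v | ∃ j k : ℕ, SuccOccurrences u w j k ∧ v = word u j (k - j)}

/-- Left extensions of `w` in `u`. -/
def Lext {A : Type*} (u : ℕ → A) (w : List A) : Set A :=
  {a | IsFactor u (a :: w)}

/-- Right extensions of `w` in `u`. -/
def Rext {A : Type*} (u : ℕ → A) (w : List A) : Set A :=
  {b | IsFactor u (w ++ [b])}

/-- Bilateral extensions of `w` in `u`. -/
def Bext {A : Type*} (u : ℕ → A) (w : List A) : Set (A × A) :=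
  {p | IsFactor u (p.1 :: (w ++ [p.2]))}

/-- Palindromic extensions of a (palindromic) factor `w` of `u`. -/
def Pext {A : Type*} (u : ℕ → A) (w : List A) : Set (List A) :=
  {v | ∃ a : A, v = a :: (w ++ [a]) ∧ IsFactor u v}

/-- `w` is a bispecial factor of `u`. -/
def Bispecial {A : Type*} (u : ℕ → A) (w : List A) : Prop :=
  IsFactor u w ∧ 2 ≤ Set.ncard (Lext u w) ∧ 2 ≤ Set.ncard (Rext u w)

/-- The bilateral order of a factor `w` of `u`. -/
noncomputable def bilateralOrder {A : Type*} (u : ℕ → A) (w : List A) : ℤ :=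
  (Set.ncard (Bext u w) : ℤ) - Set.ncard (Rext u w) - Set.ncard (Lext u w) + 1

/-- `u` is eventually periodic. -/
def EventuallyPeriodic {A : Type*} (u : ℕ → A) : Prop :=
  ∃ p : ℕ, 0 < p ∧ ∃ N : ℕ, ∀ n : ℕ, N ≤ n → u (n + p) = u n

/-- `u` is aperiodic. -/
def Aperiodic {A : Type*} (u : ℕ → A) : Prop :=
  ¬ EventuallyPeriodic u

/-- `u` is (1-)balanced. -/
def IsBalanced {A : Type*} [DecidableEq A] (u : ℕ → A) : Prop :=
  ∀ a : A, ∀ w v : List A, IsFactor u w → IsFactor u v → w.length = v.length →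
    |(w.count a : ℤ) - (v.count a : ℤ)| ≤ 1

section Helpers

variable {A : Type*}

lemma word_length (u : ℕ → A) (i n : ℕ) : (word u i n).length = n := by
  simp [word]

lemma word_getElem (u : ℕ → A) (i n m : ℕ) (h : m < (word u i n).length) :
    (word u i n)[m] = u (i + m) := by
  simp [word]

lemma word_eq_iff (u : ℕ → A) (i k n : ℕ) :
    word u i n = word u k n ↔ ∀ m < n, u (i + m) = u (k + m) := by
  simp [word]

lemma word_eq_rev_iff (u : ℕ → A) (i k n : ℕ) :
    word u i n = (word u k n).reverse ↔ ∀ m < n, u (i + m) = u (k + (n - 1 - m)) := by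
  constructor
  · intro h m hm
    have h1 : m < (word u i n).length := by rw [word_length]; exact hm
    have h2 : m < ((word u k n).reverse).length := by
      rw [List.length_reverse, word_length]; exact hm
    have h3 : (word u i n)[m] = ((word u k n).reverse)[m] := by
      simp only [h]
    rw [word_getElem, List.getElem_reverse, word_getElem, word_length] at h3
    exact h3
  · intro h
    apply List.ext_getElem
    · simp [word_length]
    · intro m h1 h2
      rw [word_getElem, List.getElem_reverse, word_getElem, word_length]
      rw [word_length] at h1
      exact h m h1

/-- the palindrome condition in terms of indices -/
lemma pal_iff (u : ℕ → A) (i n : ℕ) :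
    (word u i n).reverse = word u i n ↔ ∀ m < n, u (i + m) = u (i + (n - 1 - m)) := by
  rw [eq_comm, word_eq_rev_iff]

lemma isFactor_word (u : ℕ → A) (i n : ℕ) : IsFactor u (word u i n) :=
  ⟨i, by unfold OccursAt; rw [word_length]⟩

lemma isFactor_iff (u : ℕ → A) (w : List A) :
    IsFactor u w ↔ ∃ i, word u i w.length = w := by
  constructor
  · rintro ⟨i, h⟩; exact ⟨i, h.symm⟩
  · rintro ⟨i, h⟩; exact ⟨i, h.symm⟩

lemma word_append (u : ℕ → A) (i m n : ℕ) :
    word u i (m + n) = word u i m ++ word u (i + m) n := by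
  simp [word, List.range_add, Function.comp_def, add_assoc]

lemma infix_word_iff (u : ℕ → A) (v : List A) (i n : ℕ) :
    v <:+: word u i n ↔ ∃ s, s + v.length ≤ n ∧ v = word u (i + s) v.length := by
  constructor
  · rintro ⟨a, b, h⟩
    have hl : a.length + v.length + b.length = n := by
      have := congrArg List.length h
      simpa [word_length, add_assoc] using this
    refine ⟨a.length, by omega, ?_⟩
    rw [← hl, word_append, word_append] at h
    have h1 := (List.append_inj h (by simp [word_length])).1
    exact (List.append_inj h1 (by simp [word_length])).2
  · rintro ⟨s, hs, hv⟩
    obtain ⟨r, rfl⟩ := Nat.exists_eq_add_of_le hs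
    refine ⟨word u i s, word u (i + (s + v.length)) r, ?_⟩
    rw [word_append, word_append, ← hv]

/-- class of a word modulo reversal -/
def cl (x : List A) : Sym2 (List A) := s(x, x.reverse)

lemma cl_eq (x y : List A) : cl x = cl y ↔ x = y ∨ x = y.reverse := by
  unfold cl
  rw [Sym2.eq_iff]
  constructor
  · rintro (h | h)
    · exact Or.inl h.1
    · exact Or.inr h.1
  · rintro (h | h)
    · left; simp [h]
    · right; simp [h]

/-- class of the factor at position `i` -/
def K (u : ℕ → A) (n i : ℕ) : Sym2 (List A) := cl (word u i n)

lemma K_eq (u : ℕ → A) (n i k : ℕ) : K u n i = K u n k ↔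
    (∀ m < n, u (i + m) = u (k + m)) ∨ (∀ m < n, u (i + m) = u (k + (n - 1 - m))) := by
  unfold K
  rw [cl_eq, word_eq_iff, word_eq_rev_iff]

lemma pal_iff_K (u : ℕ → A) (n i : ℕ) :
    (word u i (n + 1)).reverse = word u i (n + 1) ↔ K u n i = K u n (i + 1) := by
  rw [pal_iff, K_eq]
  constructor
  · intro h
    right
    intro m hm
    rw [h m (by omega)]
    congr 1; omega
  · rintro (h | h)
    · have hc : ∀ m, m ≤ n → u (i + m) = u i := by
        intro m
        induction m with
        | zero => intro _; rfl
        | succ m ih =>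
          intro hm
          rw [← ih (by omega), h m (by omega)]
          congr 1; omega
      intro m hm
      rw [hc m (by omega), hc _ (by omega)]
    · intro m hm
      rcases Nat.lt_or_ge m n with hmn | hmn
      · rw [h m hmn]
        congr 1; omega
      · have : m = n := by omega
        subst this
        rcases Nat.eq_zero_or_pos m with h0 | h0
        · subst h0; rfl
        · have h1 := h 0 h0
          rw [show i + (m + 1 - 1 - m) = i + 0 by omega, h1]
          congr 1; omega

lemma K_succ (u : ℕ → A) (n a b : ℕ) (h : K u (n + 1) a = K u (n + 1) b) :
    (K u n a = K u n b ∧ K u n (a + 1) = K u n (b + 1)) ∨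
    (K u n a = K u n (b + 1) ∧ K u n (a + 1) = K u n b) := by
  rw [K_eq] at h
  rcases h with h | h
  · left
    constructor
    · rw [K_eq]; left
      intro m hm
      exact h m (by omega)
    · rw [K_eq]; left
      intro m hm
      have := h (m + 1) (by omega)
      rw [show a + 1 + m = a + (m + 1) by omega, this]
      congr 1; omega
  · right
    constructor
    · rw [K_eq]; right
      intro m hm
      rw [h m (by omega)]
      congr 1; omega
    · rw [K_eq]; right
      intro m hm
      have := h (m + 1) (by omega)
      rw [show a + 1 + m = a + (m + 1) by omega, this]
      congr 1; omega

/-- Counting: the trace of a walk is a tree iff every non-loop edge is a first-visit edge. -/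
lemma tree_count {V E : Type*} (k : ℕ → V) (l : ℕ → E)
    (hE : (Set.range l).Finite)
    (hl : ∀ a b, l a = l b → (k a = k b ∧ k (a + 1) = k (b + 1)) ∨
      (k a = k (b + 1) ∧ k (a + 1) = k b)) :
    Set.ncard (Set.range k) = Set.ncard (l '' {i | k i ≠ k (i + 1)}) + 1 ↔
    ∀ i, k i ≠ k (i + 1) → ∃ t, l t = l i ∧ ∀ r ≤ t, k r ≠ k (t + 1) := by
  classical
  set S : Set ℕ := {t | ∀ r ≤ t, k r ≠ k (t + 1)} with hS
  have hinjl : Set.InjOn l S := by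
    have key : ∀ a b, b ∈ S → l a = l b → ¬ a < b := by
      intro a b hb hab hlt
      rcases hl a b hab with h | h
      · exact hb (a + 1) (by omega) h.2
      · exact hb a (by omega) h.1
    intro a ha b hb hab
    have h1 := key a b hb hab
    have h2 := key b a ha hab.symm
    omega
  have hSfin : S.Finite := by
    apply Set.Finite.of_finite_image _ hinjl
    exact hE.subset (Set.image_subset_range _ _)
  have hinjk : Set.InjOn (fun t => k (t + 1)) S := by
    have key : ∀ a b, b ∈ S → k (a + 1) = k (b + 1) → ¬ a < b := by
      intro a b hb hab hlt
      exact hb (a + 1) (by omega) hab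
    intro a ha b hb hab
    have h1 := key a b hb hab
    have h2 := key b a ha hab.symm
    omega
  have hV : Set.range k = insert (k 0) ((fun t => k (t + 1)) '' S) := by
    apply Set.Subset.antisymm
    · rintro _ ⟨i, rfl⟩
      have hex : ∃ j, k j = k i := ⟨i, rfl⟩
      have hspec := Nat.find_spec hex
      have hmin : ∀ r, r < Nat.find hex → k r ≠ k i := fun r hr => Nat.find_min hex hr
      rcases h0 : Nat.find hex with _ | t
      · rw [h0] at hspec
        left; exact hspec.symm
      · rw [h0] at hspec hmin
        right
        refine ⟨t, ?_, hspec⟩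
        intro r hr
        rw [hspec]
        exact hmin r (by omega)
    · rintro _ (rfl | ⟨t, _, rfl⟩)
      · exact ⟨0, rfl⟩
      · exact ⟨t + 1, rfl⟩
  have hVcard : Set.ncard (Set.range k) = S.ncard + 1 := by
    have hnm : k 0 ∉ (fun t => k (t + 1)) '' S := by
      rintro ⟨t, ht, h⟩
      exact ht 0 (by omega) h.symm
    rw [hV, Set.ncard_insert_of_notMem hnm (hSfin.image _), Set.ncard_image_of_injOn hinjk]
  have hNfin : (l '' {i | k i ≠ k (i + 1)}).Finite :=
    hE.subset (Set.image_subset_range _ _)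
  have hsub : l '' S ⊆ l '' {i | k i ≠ k (i + 1)} := by
    apply Set.image_mono
    intro t ht
    exact ht t le_rfl
  rw [hVcard, Nat.add_right_cancel_iff, ← Set.ncard_image_of_injOn hinjl]
  constructor
  · intro h i hi
    have heq := Set.eq_of_subset_of_ncard_le hsub h.ge hNfin
    have : l i ∈ l '' S := by rw [heq]; exact ⟨i, hi, rfl⟩
    obtain ⟨t, ht, hti⟩ := this
    exact ⟨t, hti, ht⟩
  · intro h
    congr 1
    apply Set.Subset.antisymm hsub
    rintro _ ⟨i, hi, rfl⟩
    obtain ⟨t, hti, ht⟩ := h i hi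
    exact ⟨t, ht, hti⟩

/-- Counting of classes modulo reversal. -/
lemma two_mul_ncard_cl (S : Set (List A)) (hfin : S.Finite)
    (hrev : ∀ w ∈ S, w.reverse ∈ S) :
    2 * Set.ncard (cl '' S) = Set.ncard S + Set.ncard {w ∈ S | w.reverse = w} := by
  classical
  lift S to Finset (List A) using hfin
  have h1 : cl '' (S : Set (List A)) = ((S.image cl : Finset _) : Set _) := by simp
  have h2 : {w ∈ (S : Set (List A)) | w.reverse = w} =
      ((S.filter (fun w => w.reverse = w) : Finset _) : Set _) := by
    ext w; simp
  have h2' : {w | w ∈ (S : Set (List A)) ∧ w.reverse = w} =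
      ((S.filter (fun w => w.reverse = w) : Finset _) : Set _) := h2
  rw [h1, h2', Set.ncard_coe_finset, Set.ncard_coe_finset, Set.ncard_coe_finset]
  have h3 : S.card = ∑ c ∈ S.image cl, (S.filter (fun w => cl w = c)).card :=
    Finset.card_eq_sum_card_image cl S
  have h4 : (S.filter (fun w => w.reverse = w)).card = ∑ c ∈ S.image cl,
      ((S.filter (fun w => w.reverse = w)).filter (fun w => cl w = c)).card := by
    apply Finset.card_eq_sum_card_fiberwise
    intro w hw
    have hw' : w ∈ S := (Finset.mem_filter.mp hw).1
    exact Finset.mem_coe.mpr (Finset.mem_image_of_mem _ hw')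
  rw [h4, h3, ← Finset.sum_add_distrib, mul_comm, ← smul_eq_mul]
  symm
  apply Finset.sum_eq_card_nsmul
  intro c hc
  obtain ⟨x, hx, rfl⟩ := Finset.mem_image.mp hc
  have hf : S.filter (fun w => cl w = cl x) = {x, x.reverse} := by
    ext w
    simp only [Finset.mem_filter, cl_eq, Finset.mem_insert, Finset.mem_singleton]
    constructor
    · exact fun h => h.2
    · rintro (rfl | rfl)
      · exact ⟨hx, Or.inl rfl⟩
      · exact ⟨hrev x hx, Or.inr rfl⟩
  rw [Finset.filter_comm, hf]
  by_cases hp : x.reverse = x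
  · simp [hp, Finset.filter_singleton]
  · have hp' : x ≠ x.reverse := fun h => hp h.symm
    rw [Finset.card_pair hp']
    have : Finset.filter (fun w : List A => w.reverse = w) {x, x.reverse} = ∅ := by
      ext w
      simp only [Finset.mem_filter, Finset.mem_insert, Finset.mem_singleton,
        Finset.notMem_empty, iff_false]
      rintro ⟨rfl | rfl, h⟩
      · exact hp h
      · rw [List.reverse_reverse] at h; exact hp' h
    rw [this]; simp

/-- factors of length `n` -/
def Fac (u : ℕ → A) (n : ℕ) : Set (List A) := {w | w.length = n ∧ IsFactor u w}

lemma mem_Fac (u : ℕ → A) (n : ℕ) (w : List A) : w ∈ Fac u n ↔ ∃ i, word u i n = w := by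
  unfold Fac
  constructor
  · rintro ⟨rfl, h⟩
    exact (isFactor_iff u w).mp h
  · rintro ⟨i, rfl⟩
    exact ⟨word_length u i n, isFactor_word u i n⟩

lemma Fac_finite [Fintype A] (u : ℕ → A) (n : ℕ) : (Fac u n).Finite :=
  (List.finite_length_eq A n).subset (fun _ h => h.1)

lemma occ_late (u : ℕ → A) (hur : UniformlyRecurrent u) (i n j : ℕ) :
    ∃ k, word u (j + k) n = word u i n := by
  obtain ⟨N, hN⟩ := hur _ (isFactor_word u i n)
  obtain ⟨k, h1, _, h2⟩ := hN j
  refine ⟨k - j, ?_⟩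
  unfold OccursAt at h2
  rw [word_length] at h2
  rw [Nat.add_sub_cancel' h1]
  exact h2.symm

lemma closed_of_long (u : ℕ → A) (hur : UniformlyRecurrent u)
    (hlong : ∀ L : ℕ, ∃ i n, L ≤ n ∧ (word u i n).reverse = word u i n) :
    ClosedUnderReversal u := by
  intro w hw
  obtain ⟨N, hN⟩ := hur w hw
  obtain ⟨i, n, hn, hp⟩ := hlong (N + w.length)
  obtain ⟨j, h1, h2, h3⟩ := hN i
  rw [pal_iff] at hp
  unfold OccursAt at h3
  have : w.reverse = word u (i + n - (j - i) - w.length) w.length := by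
    symm
    conv_rhs => rw [h3]
    rw [word_eq_rev_iff]
    intro m hm
    have h := hp (n - (j - i) - w.length + m) (by omega)
    rw [show i + n - (j - i) - w.length + m = i + (n - (j - i) - w.length + m) by omega, h]
    congr 1; omega
  rw [this]
  exact isFactor_word _ _ _

/-- The equality at `n` is equivalent to the tree property from any starting point. -/
lemma equality_iff [Fintype A] (u : ℕ → A) (hur : UniformlyRecurrent u)
    (hcl : ClosedUnderReversal u) (n j : ℕ) :
    ((palComplexity u (n + 1) : ℤ) + (palComplexity u n : ℤ) =
      (complexity u (n + 1) : ℤ) - (complexity u n : ℤ) + 2) ↔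
    ∀ i, K u n (j + i) ≠ K u n (j + i + 1) →
      ∃ t, K u (n + 1) (j + t) = K u (n + 1) (j + i) ∧
        ∀ r ≤ t, K u n (j + r) ≠ K u n (j + t + 1) := by
  have hrev : ∀ m, ∀ w ∈ Fac u m, w.reverse ∈ Fac u m := by
    rintro m w ⟨h1, h2⟩
    exact ⟨by simpa using h1, hcl w h2⟩
  have hV : Set.range (fun i => K u n (j + i)) = cl '' (Fac u n) := by
    ext c
    constructor
    · rintro ⟨i, rfl⟩
      exact ⟨_, (mem_Fac u n _).mpr ⟨j + i, rfl⟩, rfl⟩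
    · rintro ⟨w, hw, rfl⟩
      obtain ⟨i, rfl⟩ := (mem_Fac u n _).mp hw
      obtain ⟨k, hk⟩ := occ_late u hur i n j
      exact ⟨k, by simp only [K, hk]⟩
  set NP : Set (List A) := {w ∈ Fac u (n + 1) | w.reverse ≠ w} with hNP
  set PP : Set (List A) := {w ∈ Fac u (n + 1) | w.reverse = w} with hPP
  have hN : (fun i => K u (n + 1) (j + i)) '' {i | K u n (j + i) ≠ K u n (j + (i + 1))} =
      cl '' NP := by
    ext c
    constructor
    · rintro ⟨i, hi, rfl⟩
      refine ⟨_, ⟨(mem_Fac u (n + 1) _).mpr ⟨j + i, rfl⟩, ?_⟩, rfl⟩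
      intro h
      exact hi ((pal_iff_K u n (j + i)).mp h)
    · rintro ⟨w, ⟨hw, hp⟩, rfl⟩
      obtain ⟨i, rfl⟩ := (mem_Fac u (n + 1) _).mp hw
      obtain ⟨k, hk⟩ := occ_late u hur i (n + 1) j
      refine ⟨k, ?_, by simp only [K, hk]⟩
      intro h
      have := (pal_iff_K u n (j + k)).mpr h
      rw [hk] at this
      exact hp this
  have hE : (Set.range (fun i => K u (n + 1) (j + i))).Finite := by
    apply ((Fac_finite u (n + 1)).image cl).subset
    rintro _ ⟨i, rfl⟩
    exact ⟨_, (mem_Fac u (n + 1) _).mpr ⟨j + i, rfl⟩, rfl⟩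
  have htree := tree_count (fun i => K u n (j + i)) (fun i => K u (n + 1) (j + i)) hE
    (fun a b hab => K_succ u n (j + a) (j + b) hab)
  have hNPfin : NP.Finite := (Fac_finite u (n + 1)).subset (fun _ h => h.1)
  have hPPfin : PP.Finite := (Fac_finite u (n + 1)).subset (fun _ h => h.1)
  have c1 := two_mul_ncard_cl (Fac u n) (Fac_finite u n) (hrev n)
  have c2 := two_mul_ncard_cl NP hNPfin (by
    rintro w ⟨h1, h2⟩
    refine ⟨hrev _ w h1, ?_⟩
    rw [List.reverse_reverse]
    exact fun h => h2 h.symm)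
  have c3 : {w ∈ NP | w.reverse = w} = ∅ := by
    ext w
    simp only [Set.mem_empty_iff_false, iff_false]
    rintro ⟨h1, h2⟩
    exact h1.2 h2
  have c4 : (Fac u (n + 1)).ncard = PP.ncard + NP.ncard := by
    rw [← Set.ncard_union_eq _ hPPfin hNPfin]
    · congr 1
      ext w
      simp only [hPP, hNP, Set.mem_union, Set.mem_setOf_eq]
      tauto
    · rw [Set.disjoint_left]
      intro w h1 h2
      exact h2.2 h1.2
  have d1 : complexity u (n + 1) = (Fac u (n + 1)).ncard := rfl
  have d2 : complexity u n = (Fac u n).ncard := rfl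
  have d3 : palComplexity u (n + 1) = PP.ncard := by
    unfold palComplexity
    congr 1
    ext w
    simp [hPP, Fac, and_assoc]
  have d4 : palComplexity u n = Set.ncard {w ∈ Fac u n | w.reverse = w} := by
    unfold palComplexity
    congr 1
    ext w
    simp [Fac, and_assoc]
  rw [c3, Set.ncard_empty] at c2
  rw [hV, hN] at htree
  rw [d1, d2, d3, d4]
  refine Iff.trans ?_ htree
  omega

/-- Rich words: every nonempty factor has a unioccurrent palindromic suffix. -/
lemma rich_suffix [Fintype A] (u : ℕ → A) (hr : Rich u) (i m : ℕ) :
    ∃ s ≤ m, (∀ x < m + 1 - s, u (i + s + x) = u (i + s + (m + 1 - s - 1 - x))) ∧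
      ∀ r < s, ¬ ∀ x < m + 1 - s, u (i + r + x) = u (i + s + x) := by
  have h1 := hr _ (isFactor_word u i (m + 1))
  have h2 := hr _ (isFactor_word u i m)
  rw [word_length] at h1 h2
  unfold palCount at h1 h2
  have hfin : {v | v <:+: word u i m ∧ v.reverse = v}.Finite := by
    apply (List.finite_length_le A m).subset
    rintro v ⟨hv, _⟩
    have := hv.length_le
    rwa [word_length] at this
  have hex : ∃ v ∈ {v | v <:+: word u i (m + 1) ∧ v.reverse = v},
      v ∉ {v | v <:+: word u i m ∧ v.reverse = v} :=
    Set.exists_mem_notMem_of_ncard_lt_ncard (by omega) hfin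
  obtain ⟨v, ⟨hv, hp⟩, hnv⟩ := hex
  have hnv' : ¬ v <:+: word u i m := fun h => hnv ⟨h, hp⟩
  rw [infix_word_iff] at hv hnv'
  obtain ⟨s, hs, hveq⟩ := hv
  push Not at hnv'
  have hsl : s + v.length = m + 1 := by
    by_contra hne
    exact hnv' s (by omega) hveq
  have hs' : s ≤ m := by
    by_contra hlt
    have h0 : v.length = 0 := by omega
    refine hnv' 0 (by omega) ?_
    have : v = [] := List.length_eq_zero_iff.mp h0
    subst this
    simp [word]
  have hl : v.length = m + 1 - s := by omega
  refine ⟨s, hs', ?_, ?_⟩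
  · rw [hveq, pal_iff, hl] at hp
    exact hp
  · intro r hrs h
    refine hnv' r (by omega) ?_
    conv_lhs => rw [hveq]
    symm
    rw [word_eq_iff, hl]
    exact h

/-- Rich words: generalized complete returns are palindromes. -/
lemma rich_return [Fintype A] (u : ℕ → A) (hr : Rich u) (n i k : ℕ) (hik : i < k)
    (hK : K u n i = K u n k) (hint : ∀ l, i < l → l < k → K u n l ≠ K u n i) :
    (word u i (k - i + n)).reverse = word u i (k - i + n) := by
  obtain ⟨s, hsm, hpal, huni⟩ := rich_suffix u hr i (k - i + n - 1)
  rw [show k - i + n - 1 + 1 = k - i + n by omega] at hpal huni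
  rcases Nat.lt_or_ge s (k - i) with hs | hs
  · have hKs : K u n (i + s) = K u n k := by
      rw [K_eq]; right
      intro x hx
      rw [hpal x (by omega)]
      congr 1; omega
    rcases Nat.eq_zero_or_pos s with h0 | h0
    · subst h0
      rw [pal_iff]
      exact hpal
    · exact absurd (hKs.trans hK.symm) (hint (i + s) (by omega) (by omega))
  · exfalso
    rw [K_eq] at hK
    rcases hK with hK | hK
    · refine huni (s - (k - i)) (by omega) ?_
      intro x hx
      have := hK (s - (k - i) + x) (by omega)
      rw [show i + (s - (k - i)) + x = i + (s - (k - i) + x) by omega, this]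
      congr 1; omega
    · refine huni 0 (by omega) ?_
      intro x hx
      rw [hpal x hx, show i + 0 + x = i + x by omega, hK x (by omega)]
      congr 1; omega

lemma rich_closed [Fintype A] (u : ℕ → A) (hur : UniformlyRecurrent u) (hr : Rich u) :
    ClosedUnderReversal u := by
  apply closed_of_long u hur
  by_contra hcon
  push Not at hcon
  obtain ⟨L, hL⟩ := hcon
  have hfin : {v : List A | v.length ≤ L}.Finite := List.finite_length_le A L
  have h := hr _ (isFactor_word u 0 (Set.ncard {v : List A | v.length ≤ L}))
  rw [word_length] at h
  unfold palCount at h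
  have hle : Set.ncard {v | v <:+: word u 0 (Set.ncard {v : List A | v.length ≤ L}) ∧
      v.reverse = v} ≤ Set.ncard {v : List A | v.length ≤ L} := by
    apply Set.ncard_le_ncard _ hfin
    rintro v ⟨h1, h2⟩
    obtain ⟨s, _, hv⟩ := (infix_word_iff u v _ _).mp h1
    by_contra hlt
    simp only [Set.mem_setOf_eq, not_le] at hlt
    rw [hv] at h2
    exact hL _ _ hlt.le h2
  omega

/-- Generalized complete returns are palindromes, from the equality. -/
lemma eq_return [Fintype A] (u : ℕ → A) (hur : UniformlyRecurrent u)
    (hcl : ClosedUnderReversal u)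
    (heq : ∀ n : ℕ, (palComplexity u (n + 1) : ℤ) + (palComplexity u n : ℤ) =
      (complexity u (n + 1) : ℤ) - (complexity u n : ℤ) + 2) (j : ℕ) :
    ∀ d n : ℕ, K u n j = K u n (j + d + 1) →
      (∀ l, j < l → l < j + d + 1 → K u n l ≠ K u n j) →
      (word u j (d + 1 + n)).reverse = word u j (d + 1 + n) := by
  intro d
  induction d with
  | zero =>
    intro n hK _
    have := (pal_iff_K u n j).mpr hK
    rwa [show 0 + 1 + n = n + 1 by omega]
  | succ d ih =>
    intro n hK hint
    have hne : K u n (j + (d + 1)) ≠ K u n (j + (d + 1) + 1) := by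
      rw [← hK]
      exact hint _ (by omega) (by omega)
    obtain ⟨t, ht, hfirst⟩ := (equality_iff u hur hcl n j).mp (heq n) (d + 1) hne
    have ht0 : t = 0 := by
      rcases K_succ u n _ _ ht with h | h
      · exact absurd (hK.trans h.2.symm) (hfirst 0 (by omega))
      · by_contra h0
        have htd : t < d + 1 := by
          by_contra hge
          exact hfirst (d + 1) (by omega) h.2.symm
        exact hint (j + t) (by omega) (by omega) (h.1.trans hK.symm)
    subst ht0
    have := ih (n + 1) ht (by
      intro l hl1 hl2 hl
      rcases K_succ u n _ _ hl with h | h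
      · exact hint l hl1 (by omega) h.1
      · exact hint (l + 1) (by omega) (by omega) h.2)
    rwa [show d + 1 + 1 + n = d + 1 + (n + 1) by omega]

lemma rich_of_return [Fintype A] (u : ℕ → A)
    (hret : ∀ j d n : ℕ, K u n j = K u n (j + d + 1) →
      (∀ l, j < l → l < j + d + 1 → K u n l ≠ K u n j) →
      (word u j (d + 1 + n)).reverse = word u j (d + 1 + n)) : Rich u := by
  classical
  have main : ∀ i m, palCount (word u i m) = m + 1 := by
    intro i m
    induction m with
    | zero =>
      unfold palCount
      have : {v : List A | v <:+: word u i 0 ∧ v.reverse = v} = {[]} := by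
        ext v
        simp only [word, List.range_zero, List.map_nil, Set.mem_setOf_eq,
          Set.mem_singleton_iff, List.infix_nil]
        constructor
        · exact fun h => h.1
        · rintro rfl; simp
      rw [this, Set.ncard_singleton]
    | succ m ih =>
      have hex : ∃ s, s ≤ m + 1 ∧ (word u (i + s) (m + 1 - s)).reverse =
          word u (i + s) (m + 1 - s) := ⟨m + 1, le_rfl, by simp [word]⟩
      have hlast : (m : ℕ) ≤ m + 1 ∧ (word u (i + m) (m + 1 - m)).reverse =
          word u (i + m) (m + 1 - m) := by
        refine ⟨by omega, ?_⟩
        rw [show m + 1 - m = 1 by omega]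
        simp [word]
      have hsm : Nat.find hex ≤ m := Nat.find_min' hex hlast
      obtain ⟨_, hpal⟩ := Nat.find_spec hex
      have hmin : ∀ r, r < Nat.find hex → ¬ ((word u (i + r) (m + 1 - r)).reverse =
          word u (i + r) (m + 1 - r)) := by
        intro r hr h
        exact Nat.find_min hex hr ⟨by omega, h⟩
      generalize Nat.find hex = s at hsm hpal hmin
      have hset : {v : List A | v <:+: word u i (m + 1) ∧ v.reverse = v} =
          insert (word u (i + s) (m + 1 - s)) {v | v <:+: word u i m ∧ v.reverse = v} := by
        ext v
        simp only [Set.mem_setOf_eq, Set.mem_insert_iff]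
        constructor
        · rintro ⟨h1, h2⟩
          rw [infix_word_iff] at h1
          obtain ⟨r, hr, hv⟩ := h1
          by_cases hrm : r + v.length ≤ m
          · right
            exact ⟨(infix_word_iff u v i m).mpr ⟨r, hrm, hv⟩, h2⟩
          · have hl : v.length = m + 1 - r := by omega
            rcases lt_trichotomy r s with hlt | heq | hgt
            · exfalso
              apply hmin r hlt
              rw [← hl, ← hv, h2]
            · left
              rw [hv, hl, heq]
            · right
              refine ⟨(infix_word_iff u v i m).mpr ⟨s, by omega, ?_⟩, h2⟩
              rw [← h2]
              conv_lhs => rw [hv]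
              rw [List.length_reverse]
              symm
              rw [word_eq_rev_iff]
              rw [pal_iff] at hpal
              intro x hx
              rw [hpal x (by omega)]
              congr 1; omega
        · rintro (rfl | ⟨h1, h2⟩)
          · refine ⟨(infix_word_iff u _ i _).mpr ⟨s, ?_, ?_⟩, hpal⟩
            · rw [word_length]; omega
            · rw [word_length]
          · refine ⟨?_, h2⟩
            rw [infix_word_iff] at h1 ⊢
            obtain ⟨r, hr, hv⟩ := h1
            exact ⟨r, by omega, hv⟩
      have hnot : word u (i + s) (m + 1 - s) ∉ {v | v <:+: word u i m ∧ v.reverse = v} := by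
        rintro ⟨h1, _⟩
        rw [infix_word_iff, word_length] at h1
        obtain ⟨r, hr, hv⟩ := h1
        have hP : ∃ d, d < s ∧ K u (m + 1 - s) (i + (s - 1 - d)) = K u (m + 1 - s) (i + s) := by
          refine ⟨s - 1 - r, by omega, ?_⟩
          rw [show s - 1 - (s - 1 - r) = r by omega]
          unfold K
          rw [hv]
        obtain ⟨hd1, hd2⟩ := Nat.find_spec hP
        have hd3 : ∀ e, e < Nat.find hP →
            ¬ (e < s ∧ K u (m + 1 - s) (i + (s - 1 - e)) = K u (m + 1 - s) (i + s)) :=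
          fun e he => Nat.find_min hP he
        generalize Nat.find hP = d at hd1 hd2 hd3
        have := hret (i + (s - 1 - d)) d (m + 1 - s) (by
          rw [hd2]; congr 1; omega) (by
          intro l hl1 hl2 hl
          refine hd3 (i + s - 1 - l) (by omega) ⟨by omega, ?_⟩
          rw [← hd2, ← hl]
          congr 1; omega)
        apply hmin (s - 1 - d) (by omega)
        rw [show m + 1 - (s - 1 - d) = d + 1 + (m + 1 - s) by omega]
        exact this
      have hfin : {v | v <:+: word u i m ∧ v.reverse = v}.Finite := by
        apply (List.finite_length_le A m).subset
        rintro v ⟨hv, _⟩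
        have := hv.length_le
        rwa [word_length] at this
      unfold palCount at ih ⊢
      rw [hset, Set.ncard_insert_of_notMem hnot hfin, ih]
  intro w hw
  obtain ⟨i, hi⟩ := (isFactor_iff u w).mp hw
  have := main i w.length
  rwa [hi] at this

lemma complexity_mono [Fintype A] (u : ℕ → A) (n : ℕ) :
    complexity u n ≤ complexity u (n + 1) := by
  change (Fac u n).ncard ≤ (Fac u (n + 1)).ncard
  have : Fac u n ⊆ (fun w => w.take n) '' Fac u (n + 1) := by
    intro w hw
    obtain ⟨i, rfl⟩ := (mem_Fac u n w).mp hw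
    refine ⟨word u i (n + 1), (mem_Fac u (n + 1) _).mpr ⟨i, rfl⟩, ?_⟩
    simp only [word_append]
    rw [List.take_left' (word_length u i n)]
  exact (Set.ncard_le_ncard this ((Fac_finite u (n + 1)).image _)).trans
    (Set.ncard_image_le (Fac_finite u (n + 1)))

lemma eq_closed [Fintype A] (u : ℕ → A) (hur : UniformlyRecurrent u)
    (heq : ∀ n : ℕ, (palComplexity u (n + 1) : ℤ) + (palComplexity u n : ℤ) =
      (complexity u (n + 1) : ℤ) - (complexity u n : ℤ) + 2) :
    ClosedUnderReversal u := by
  apply closed_of_long u hur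
  intro L
  have h1 := heq L
  have h2 := complexity_mono u L
  have key : ∀ n, palComplexity u n ≠ 0 → ∃ i, (word u i n).reverse = word u i n := by
    intro n hn
    obtain ⟨w, hw1, hw2, hw3⟩ := Set.nonempty_of_ncard_ne_zero hn
    obtain ⟨i, hi⟩ := (mem_Fac u n w).mp ⟨hw1, hw2⟩
    exact ⟨i, by rw [hi, hw3]⟩
  by_cases h0 : palComplexity u L = 0
  · obtain ⟨i, hi⟩ := key (L + 1) (by omega)
    exact ⟨i, L + 1, by omega, hi⟩
  · obtain ⟨i, hi⟩ := key L h0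
    exact ⟨i, L, le_rfl, hi⟩

lemma rich_tree [Fintype A] (u : ℕ → A) (hr : Rich u) (n : ℕ) :
    ∀ i, K u n (0 + i) ≠ K u n (0 + i + 1) →
      ∃ t, K u (n + 1) (0 + t) = K u (n + 1) (0 + i) ∧
        ∀ r ≤ t, K u n (0 + r) ≠ K u n (0 + t + 1) := by
  classical
  intro i hi
  simp only [Nat.zero_add] at hi ⊢
  have hex : ∃ t, K u (n + 1) t = K u (n + 1) i := ⟨i, rfl⟩
  have ht := Nat.find_spec hex
  have hmin : ∀ r, r < Nat.find hex → K u (n + 1) r ≠ K u (n + 1) i :=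
    fun r h => Nat.find_min hex h
  generalize Nat.find hex = t at ht hmin
  refine ⟨t, ht, ?_⟩
  intro r hrt hr1
  have hne : K u n t ≠ K u n (t + 1) := by
    intro h
    rcases K_succ u n _ _ ht with h' | h'
    · exact hi (h'.1.symm.trans (h.trans h'.2))
    · exact hi (h'.2.symm.trans (h.symm.trans h'.1))
  have hP : ∃ d, d ≤ t ∧ K u n (t - d) = K u n (t + 1) :=
    ⟨t - r, by omega, by rw [show t - (t - r) = r by omega, hr1]⟩
  obtain ⟨hd1, hd2⟩ := Nat.find_spec hP
  have hd3 : ∀ e, e < Nat.find hP → ¬ (e ≤ t ∧ K u n (t - e) = K u n (t + 1)) :=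
    fun e he => Nat.find_min hP he
  generalize Nat.find hP = d at hd1 hd2 hd3
  have hd0 : 0 < d := by
    rcases Nat.eq_zero_or_pos d with h0 | h0
    · subst h0; exact absurd hd2 hne
    · exact h0
  have hpal := rich_return u hr n (t - d) (t + 1) (by omega) hd2 (by
    intro l hl1 hl2 hl
    refine hd3 (t - l) (by omega) ⟨by omega, ?_⟩
    rw [show t - (t - l) = l by omega, hl, hd2])
  rw [pal_iff] at hpal
  refine hmin (t - d) (by omega) ?_
  rw [← ht, K_eq]
  right
  intro x hx
  rw [hpal x (by omega)]
  congr 1; omega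

end Helpers

/-- A uniformly recurrent infinite word `u` is rich iff
`P(n+1) + P(n) = C(n+1) − C(n) + 2` for all `n`. -/
theorem stmt6 {A : Type*} [Fintype A] (u : ℕ → A)
    (hall : AllLettersOccur u)
    (hur : UniformlyRecurrent u) :
    Rich u ↔ ∀ n : ℕ, (palComplexity u (n + 1) : ℤ) + (palComplexity u n : ℤ) =
      (complexity u (n + 1) : ℤ) - (complexity u n : ℤ) + 2 := by
  constructor
  · intro hr n
    exact (equality_iff u hur (rich_closed u hur hr) n 0).mpr (rich_tree u hr n)
  · intro heq
    have hcl := eq_closed u hur heq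
    exact rich_of_return u (fun j => eq_return u hur hcl heq j)
end

section
/- An infinite word u over a two-letter alphabet is Sturmian (i.e., its factor complexity satisfies C(n) = n + 1 for all n ∈ ℕ) if and only if u is aperiodic and balanced. -/
open List

theorem wd_length {A : Type*} (u : ℕ → A) (i n : ℕ) : (word u i n).length = n := by
  simp [word]

theorem wd_succ {A : Type*} (u : ℕ → A) (i n : ℕ) :
    word u i (n + 1) = word u i n ++ [u (i + n)] := by
  simp [word, List.range_succ]

theorem wd_eq {A : Type*} (u : ℕ → A) (i j n : ℕ) :
    word u i n = word u j n ↔ ∀ k < n, u (i + k) = u (j + k) := by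
  simp [word]

theorem wd_succ_eq {A : Type*} (u : ℕ → A) (i j n : ℕ) :
    word u i (n + 1) = word u j (n + 1) ↔ word u i n = word u j n ∧ u (i + n) = u (j + n) := by
  rw [wd_eq, wd_eq]
  constructor
  · intro h
    exact ⟨fun k hk => h k (by omega), h n (by omega)⟩
  · rintro ⟨h1, h2⟩ k hk
    rcases Nat.lt_succ_iff_lt_or_eq.mp hk with h | rfl
    · exact h1 k h
    · exact h2

theorem wd_shift {A : Type*} (u : ℕ → A) (i j n : ℕ) (h : word u i n = word u j n)
    (h2 : u (i + n) = u (j + n)) : word u (i + 1) n = word u (j + 1) n := by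
  have h3 := (wd_succ_eq u i j n).2 ⟨h, h2⟩
  rw [wd_eq] at h3 ⊢
  intro k hk
  have := h3 (k + 1) (by omega)
  rw [show i + 1 + k = i + (k + 1) by omega, show j + 1 + k = j + (k + 1) by omega]
  exact this

theorem factors_eq {A : Type*} (u : ℕ → A) (n : ℕ) :
    {w : List A | w.length = n ∧ IsFactor u w} = Set.range (fun i => word u i n) := by
  ext w
  simp only [Set.mem_setOf_eq, Set.mem_range, IsFactor, OccursAt]
  constructor
  · rintro ⟨rfl, i, hi⟩
    exact ⟨i, hi.symm⟩
  · rintro ⟨i, rfl⟩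
    exact ⟨wd_length _ _ _, i, by rw [wd_length]⟩

theorem cx_eq {A : Type*} (u : ℕ → A) (n : ℕ) :
    complexity u n = (Set.range (fun i => word u i n)).ncard := by
  rw [complexity, factors_eq]

theorem fin_range {A : Type*} [Fintype A] (u : ℕ → A) (n : ℕ) :
    (Set.range (fun i => word u i n)).Finite := by
  refine (List.finite_length_eq A n).subset ?_
  rintro _ ⟨i, rfl⟩
  exact wd_length _ _ _

theorem cx_zero {A : Type*} (u : ℕ → A) : complexity u 0 = 1 := by
  rw [cx_eq]
  simp [word]

theorem dropLast_wd {A : Type*} (u : ℕ → A) (i n : ℕ) :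
    (word u i (n + 1)).dropLast = word u i n := by
  rw [wd_succ]; simp

/-- Eventual periodicity bounds the complexity. -/
theorem cx_le_of_periodic {A : Type*} (u : ℕ → A) (h : EventuallyPeriodic u) :
    ∃ M, ∀ n, complexity u n ≤ M := by
  classical
  obtain ⟨p, hp, N, hN⟩ := h
  refine ⟨N + p, fun n => ?_⟩
  have key : ∀ i, ∃ j < N + p, word u i n = word u j n := by
    intro i
    induction i using Nat.strong_induction_on with
    | _ i ih =>
      by_cases hi : i < N + p
      · exact ⟨i, hi, rfl⟩
      · obtain ⟨j, hj, e⟩ := ih (i - p) (by omega)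
        refine ⟨j, hj, ?_⟩
        rw [← e, wd_eq]
        intro k _
        have := hN (i - p + k) (by omega)
        rw [← this]
        congr 1
        omega
  rw [cx_eq]
  have hs : Set.range (fun i => word u i n) ⊆
      ((Finset.range (N + p)).image (fun i => word u i n) : Finset (List A)) := by
    rintro _ ⟨i, rfl⟩
    obtain ⟨j, hj, e⟩ := key i
    simp only [Finset.coe_image, Set.mem_image, Finset.coe_range, Set.mem_Iio]
    exact ⟨j, hj, e.symm⟩
  calc _ ≤ _ := Set.ncard_le_ncard hs (Finset.finite_toSet _)
    _ = _ := Set.ncard_coe_finset _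
    _ ≤ _ := Finset.card_image_le
    _ = _ := by simp

/-- A repetition without right special factors in between forces eventual periodicity. -/
theorem periodic_of_rep {A : Type*} (u : ℕ → A) (n i j : ℕ) (hij : i < j)
    (h : word u i n = word u j n)
    (hns : ∀ s, i ≤ s → s < j → ∀ t, word u s n = word u t n → u (s + n) = u (t + n)) :
    EventuallyPeriodic u := by
  have key : ∀ t, ∃ s, i ≤ s ∧ s < j ∧ word u s n = word u (i + t) n := by
    intro t
    induction t with
    | zero => exact ⟨i, le_refl _, hij, rfl⟩
    | succ t ih =>
      obtain ⟨s, h1, h2, e⟩ := ih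
      have e2 := wd_shift u s (i + t) n e (hns s h1 h2 _ e)
      by_cases hs : s + 1 < j
      · exact ⟨s + 1, by omega, hs, e2⟩
      · have : s + 1 = j := by omega
        rw [this] at e2
        exact ⟨i, le_refl _, hij, h.trans e2⟩
  have k2 : ∀ t, word u (i + t) n = word u (j + t) n ∧ u (i + t + n) = u (j + t + n) := by
    intro t
    have aux : ∀ t, word u (i + t) n = word u (j + t) n → u (i + t + n) = u (j + t + n) := by
      intro t ht
      obtain ⟨s, h1, h2, e⟩ := key t
      rw [← hns s h1 h2 _ e, ← hns s h1 h2 _ (e.trans ht)]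
    induction t with
    | zero => exact ⟨h, aux 0 h⟩
    | succ t ih =>
      have := wd_shift u _ _ n ih.1 ih.2
      exact ⟨this, aux (t + 1) this⟩
  refine ⟨j - i, by omega, i + n, fun m hm => ?_⟩
  have := (k2 (m - (i + n))).2
  rw [show i + (m - (i + n)) + n = m by omega] at this
  rw [this]
  congr 1
  omega

/-- If no right special factor of length `n` exists, `u` is eventually periodic. -/
theorem exists_special {A : Type*} [Fintype A] (u : ℕ → A) (hu : Aperiodic u) (n : ℕ) :
    ∃ s t, word u s n = word u t n ∧ u (s + n) ≠ u (t + n) := by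
  by_contra! hc
  have hf := fin_range u n
  have : ¬ Function.Injective (fun i => word u i n) := fun hi =>
    Set.infinite_range_of_injective hi hf
  simp only [Function.Injective] at this
  push Not at this
  obtain ⟨i, j, e, hne⟩ := this
  rcases lt_or_gt_of_ne hne with h | h
  · exact hu (periodic_of_rep u n i j h e (fun s _ _ t e => hc s t e))
  · exact hu (periodic_of_rep u n j i h e.symm (fun s _ _ t e => hc s t e))

theorem cx_lt {A : Type*} [Fintype A] (u : ℕ → A) (hu : Aperiodic u) (n : ℕ) :
    complexity u n < complexity u (n + 1) := by
  obtain ⟨s, t, e, hne⟩ := exists_special u hu n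
  rw [cx_eq, cx_eq]
  have hsub : Set.range (fun i => word u i n) ⊆
      List.dropLast '' (Set.range (fun i => word u i (n + 1)) \ {word u s (n + 1)}) := by
    rintro _ ⟨i, rfl⟩
    by_cases h : word u i (n + 1) = word u s (n + 1)
    · refine ⟨word u t (n + 1), ⟨⟨t, rfl⟩, ?_⟩, ?_⟩
      · intro h2
        exact hne ((wd_succ_eq u _ _ n).1 h2).2.symm
      · rw [dropLast_wd]
        exact e.symm.trans ((wd_succ_eq u _ _ n).1 h).1.symm
    · exact ⟨_, ⟨⟨i, rfl⟩, h⟩, dropLast_wd _ _ _⟩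
  have hf := fin_range u (n + 1)
  calc _ ≤ _ := Set.ncard_le_ncard hsub ((hf.diff).image _)
    _ ≤ _ := Set.ncard_image_le hf.diff
    _ < _ := Set.ncard_diff_singleton_lt_of_mem ⟨s, rfl⟩ hf

/-- Uniqueness of right special factors of length `n`. -/
def UniqSpecial {A : Type*} (u : ℕ → A) (n : ℕ) : Prop :=
  ∀ i i' j j', word u i n = word u i' n → u (i + n) ≠ u (i' + n) →
    word u j n = word u j' n → u (j + n) ≠ u (j' + n) → word u i n = word u j n

theorem uniq_of_cx {A : Type*} [Fintype A] (u : ℕ → A) (n : ℕ)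
    (h : complexity u (n + 1) = complexity u n + 1) : UniqSpecial u n := by
  intro i i' j j' e1 d1 e2 d2
  by_contra hne
  rw [cx_eq, cx_eq] at h
  have hsub : Set.range (fun i => word u i n) ⊆
      List.dropLast '' ((Set.range (fun i => word u i (n + 1)) \ {word u i (n + 1)}) \
        {word u j (n + 1)}) := by
    rintro _ ⟨t, rfl⟩
    by_cases h : word u t (n + 1) = word u i (n + 1)
    · refine ⟨word u i' (n + 1), ⟨⟨⟨i', rfl⟩, ?_⟩, ?_⟩, ?_⟩
      · intro h2
        exact d1 ((wd_succ_eq u _ _ n).1 h2).2.symm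
      · intro h2
        exact hne (e1.trans ((wd_succ_eq u _ _ n).1 h2).1)
      · rw [dropLast_wd]
        exact e1.symm.trans ((wd_succ_eq u _ _ n).1 h).1.symm
    by_cases h' : word u t (n + 1) = word u j (n + 1)
    · refine ⟨word u j' (n + 1), ⟨⟨⟨j', rfl⟩, ?_⟩, ?_⟩, ?_⟩
      · intro h2
        exact hne (e2.trans ((wd_succ_eq u _ _ n).1 h2).1).symm
      · intro h2
        exact d2 ((wd_succ_eq u _ _ n).1 h2).2.symm
      · rw [dropLast_wd]
        exact e2.symm.trans ((wd_succ_eq u _ _ n).1 h').1.symm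
    · exact ⟨_, ⟨⟨⟨t, rfl⟩, h⟩, h'⟩, dropLast_wd _ _ _⟩
  have hf := fin_range u (n + 1)
  have h1 := Set.ncard_le_ncard hsub ((hf.diff.diff).image _)
  have h2 := Set.ncard_image_le (f := List.dropLast) (hf.diff.diff (t := {word u j (n + 1)})
    (s := Set.range (fun i => word u i (n + 1)) \ {word u i (n + 1)}))
  have h3 := Set.ncard_diff_singleton_lt_of_mem
    (s := Set.range (fun i => word u i (n + 1))) (a := word u i (n + 1)) ⟨i, rfl⟩ hf
  have h4 := Set.ncard_diff_singleton_lt_of_mem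
    (s := Set.range (fun i => word u i (n + 1)) \ {word u i (n + 1)}) (a := word u j (n + 1))
    ⟨⟨j, rfl⟩, fun h2 => hne ((wd_succ_eq u _ _ n).1 h2).1.symm⟩ hf.diff
  omega

theorem cx_of_uniq {A : Type*} [Fintype A] (u : ℕ → A) (n : ℕ) (a b : A)
    (hab : ∀ x, x = a ∨ x = b) (h : UniqSpecial u n) :
    complexity u (n + 1) ≤ complexity u n + 1 := by
  rw [cx_eq, cx_eq]
  have hf := fin_range u n
  have hf1 := fin_range u (n + 1)
  have hmaps : ∀ w ∈ Set.range (fun i => word u i (n + 1)),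
      w.dropLast ∈ Set.range (fun i => word u i n) := by
    rintro _ ⟨i, rfl⟩
    exact ⟨i, (dropLast_wd _ _ _).symm⟩
  by_cases hs : ∃ s t, word u s n = word u t n ∧ u (s + n) ≠ u (t + n)
  · obtain ⟨s, t, e, d⟩ := hs
    have h1 : (Set.range (fun i => word u i (n + 1)) \ {word u s (n + 1)}).ncard ≤
        (Set.range (fun i => word u i n)).ncard := by
      refine Set.ncard_le_ncard_of_injOn List.dropLast (fun w hw => hmaps w hw.1) ?_ hf
      rintro _ ⟨⟨i, rfl⟩, hi⟩ _ ⟨⟨j, rfl⟩, hj⟩ hij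
      simp only [dropLast_wd] at hij
      simp only [Set.mem_singleton_iff, wd_succ_eq, not_and] at hi hj
      refine (wd_succ_eq u i j n).2 ⟨hij, ?_⟩
      by_contra hne
      have e1 := h i j s t hij hne e d
      have hi := hi e1
      have hj := hj (hij.symm.trans e1)
      rcases hab (u (i + n)) with h1 | h1 <;> rcases hab (u (j + n)) with h2 | h2 <;>
        rcases hab (u (s + n)) with h3 | h3 <;> simp_all
    have h2 := Set.ncard_diff_singleton_add_one
      (s := Set.range (fun i => word u i (n + 1))) (a := word u s (n + 1)) ⟨s, rfl⟩ hf1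
    omega
  · push Not at hs
    refine (Set.ncard_le_ncard_of_injOn List.dropLast hmaps ?_ hf).trans (Nat.le_succ _)
    rintro _ ⟨i, rfl⟩ _ ⟨j, rfl⟩ hij
    simp only [dropLast_wd] at hij
    exact (wd_succ_eq u i j n).2 ⟨hij, hs i j hij⟩

/-- Number of occurrences of `a` among the first `n` letters of `u`. -/
def pre {A : Type*} [DecidableEq A] (u : ℕ → A) (a : A) : ℕ → ℤ
  | 0 => 0
  | n + 1 => pre u a n + if u n = a then 1 else 0

theorem count_wd {A : Type*} [DecidableEq A] (u : ℕ → A) (a : A) (i n : ℕ) :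
    ((word u i n).count a : ℤ) = pre u a (i + n) - pre u a i := by
  induction n with
  | zero => simp [word]
  | succ n ih =>
    rw [wd_succ, List.count_append]
    push_cast
    rw [ih, ← Nat.add_assoc, pre, List.count_singleton]
    by_cases h : u (i + n) = a <;> simp [h] <;> ring

theorem bal_iff {A : Type*} [DecidableEq A] (u : ℕ → A) :
    IsBalanced u ↔ ∀ a i j n,
      (pre u a (i + n) - pre u a i) - (pre u a (j + n) - pre u a j) ≤ 1 := by
  constructor
  · intro h a i j n
    have := h a (word u i n) (word u j n) ⟨i, by rw [OccursAt, wd_length]⟩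
      ⟨j, by rw [OccursAt, wd_length]⟩ (by simp [wd_length])
    rw [count_wd, count_wd] at this
    exact (abs_le.1 this).2
  · rintro h a w v ⟨i, hi⟩ ⟨j, hj⟩ hl
    rw [OccursAt] at hi hj
    rw [hi, hj, count_wd, count_wd, hl, abs_le]
    have h1 := h a i j v.length
    have h2 := h a j i v.length
    constructor <;> linarith

theorem uniq_of_bal {A : Type*} [DecidableEq A] (u : ℕ → A) (a b : A)
    (hab : ∀ x, x = a ∨ x = b) (hne : a ≠ b) (h : IsBalanced u) (n : ℕ) : UniqSpecial u n := by
  rw [bal_iff] at h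
  -- core: the case where the pairs are normalised
  have core : ∀ i i' j j', word u i n = word u i' n → word u j n = word u j' n →
      u (i + n) = a → u (i' + n) = b → u (j + n) = a → u (j' + n) = b →
      word u i n = word u j n := by
    intro i i' j j' e1 e2 hi hi' hj hj'
    rw [wd_eq] at e1 e2
    have main : ∀ d, d ≤ n → ∀ k, n - d ≤ k → k < n → u (i + k) = u (j + k) := by
      intro d
      induction d with
      | zero => intro _ k h1 h2; omega
      | succ d ih =>
        intro hd k h1 h2
        by_cases hk : n - d ≤ k
        · exact ih (by omega) k hk h2
        have ih := ih (by omega)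
        -- all four words agree on counts of the common suffix
        have suf : ∀ x y : ℕ, (∀ l, k + 1 ≤ l → l < n → u (x + l) = u (y + l)) →
            pre u a (x + n) - pre u a (x + k + 1) = pre u a (y + n) - pre u a (y + k + 1) := by
          intro x y hxy
          have : ∀ m, k + 1 + m ≤ n → pre u a (x + (k + 1 + m)) - pre u a (x + k + 1) =
              pre u a (y + (k + 1 + m)) - pre u a (y + k + 1) := by
            intro m
            induction m with
            | zero => intro _; simp [Nat.add_assoc]
            | succ m ihm =>
              intro hm
              have e := hxy (k + 1 + m) (by omega) (by omega)
              have := ihm (by omega)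
              have p1 : pre u a (x + (k + 1 + (m + 1))) = pre u a (x + (k + 1 + m)) +
                if u (x + (k + 1 + m)) = a then 1 else 0 := rfl
              have p2 : pre u a (y + (k + 1 + (m + 1))) = pre u a (y + (k + 1 + m)) +
                if u (y + (k + 1 + m)) = a then 1 else 0 := rfl
              rw [p1, p2, e]
              linarith
          have := this (n - (k + 1)) (by omega)
          rwa [show k + 1 + (n - (k + 1)) = n by omega] at this
        have wnd : ∀ x y : ℕ, (∀ l, k + 1 ≤ l → l < n → u (x + l) = u (y + l)) →
            u (x + k) = a → u (x + n) = a → u (y + k) = b → u (y + n) = b → False := by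
          intro x y hxy h1 h2 h3 h4
          have hs := suf x y hxy
          have q := h a (x + k) (y + k) (n + 1 - k)
          rw [show x + k + (n + 1 - k) = x + n + 1 by omega,
            show y + k + (n + 1 - k) = y + n + 1 by omega] at q
          have p1 : pre u a (x + n + 1) = pre u a (x + n) + if u (x + n) = a then 1 else 0 := rfl
          have p2 : pre u a (y + n + 1) = pre u a (y + n) + if u (y + n) = a then 1 else 0 := rfl
          have p3 : pre u a (x + k + 1) = pre u a (x + k) + if u (x + k) = a then 1 else 0 := rfl
          have p4 : pre u a (y + k + 1) = pre u a (y + k) + if u (y + k) = a then 1 else 0 := rfl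
          simp only [h1, h2, h3, h4, if_true, hne.symm, if_false] at p1 p2 p3 p4
          omega
        rcases hab (u (i + k)) with c1 | c1 <;> rcases hab (u (j + k)) with c2 | c2
        · rw [c1, c2]
        · exfalso
          refine wnd i j' (fun l l1 l2 => ?_) c1 hi ?_ hj'
          · rw [ih l (by omega) l2, e2 l l2]
          · rw [← e2 k h2, c2]
        · exfalso
          refine wnd j i' (fun l l1 l2 => ?_) c2 hj ?_ hi'
          · rw [← ih l (by omega) l2, e1 l l2]
          · rw [← e1 k h2, c1]
        · rw [c1, c2]
    rw [wd_eq]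
    intro k hk
    exact main n le_rfl k (by omega) hk
  intro i i' j j' e1 d1 e2 d2
  rcases hab (u (i + n)) with c1 | c1 <;> rcases hab (u (i' + n)) with c2 | c2 <;>
    rcases hab (u (j + n)) with c3 | c3 <;> rcases hab (u (j' + n)) with c4 | c4 <;>
    first
    | exact absurd (c1.trans c2.symm) d1
    | exact absurd (c3.trans c4.symm) d2
    | skip
  · exact core i i' j j' e1 e2 c1 c2 c3 c4
  · exact (core i i' j' j e1 e2.symm c1 c2 c4 c3).trans e2.symm
  · exact e1.trans (core i' i j j' e1.symm e2 c2 c1 c3 c4)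
  · exact e1.trans ((core i' i j' j e1.symm e2.symm c2 c1 c4 c3).trans e2.symm)

/-- An unbalanced word contains `awa` and `bwb` with `w` a palindrome. -/
theorem unbal {A : Type*} [DecidableEq A] (u : ℕ → A) (a b : A)
    (hab : ∀ x, x = a ∨ x = b) (h : ¬ IsBalanced u) :
    ∃ n i j, 1 ≤ n ∧ u i = u (i + n) ∧ u j = u (j + n) ∧ u i ≠ u j ∧
      (∀ k, 0 < k → k < n → u (i + k) = u (j + k)) ∧
      (∀ k, 0 < k → k < n → u (i + k) = u (i + (n - k))) := by
  classical
  rw [bal_iff] at h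
  push Not at h
  obtain ⟨c, i0, j0, n0, h0⟩ := h
  have hex : ∃ L, ∃ i j, 1 < (pre u c (i + L) - pre u c i) - (pre u c (j + L) - pre u c j) :=
    ⟨n0, i0, j0, h0⟩
  obtain ⟨i, j, hL⟩ := Nat.find_spec hex
  have hmin : ∀ m < Nat.find hex, ∀ i j,
      (pre u c (i + m) - pre u c i) - (pre u c (j + m) - pre u c j) ≤ 1 := by
    intro m hm i j
    have := Nat.find_min hex hm
    push Not at this
    exact this i j
  generalize Nat.find hex = L at hL hmin
  have st : ∀ x, pre u c (x + 1) = pre u c x + 1 ∧ u x = c ∨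
      pre u c (x + 1) = pre u c x ∧ u x ≠ c := by
    intro x
    by_cases hx : u x = c
    · left; exact ⟨by rw [pre, if_pos hx], hx⟩
    · right; exact ⟨by rw [pre, if_neg hx, add_zero], hx⟩
  have two : ∀ x y, (u x ≠ c) → (u y ≠ c) → u x = u y := by
    intro x y h1 h2
    rcases hab c with r | r <;> rcases hab (u x) with h3 | h3 <;>
      rcases hab (u y) with h4 | h4 <;> simp_all
  have eqof : ∀ x y, pre u c (x + 1) - pre u c x = pre u c (y + 1) - pre u c y → u x = u y := by
    intro x y hxy
    rcases st x with ⟨h1, h2⟩ | ⟨h1, h2⟩ <;> rcases st y with ⟨h3, h4⟩ | ⟨h3, h4⟩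
    · rw [h2, h4]
    · omega
    · omega
    · exact two x y h2 h4
  have hL2 : 2 ≤ L := by
    by_contra hc
    have : L = 0 ∨ L = 1 := by omega
    rcases this with rfl | rfl
    · simp at hL
    · rcases st i with ⟨h1, h2⟩ | ⟨h1, h2⟩ <;> rcases st j with ⟨h3, h4⟩ | ⟨h3, h4⟩ <;> omega
  obtain ⟨n, rfl⟩ : ∃ n, L = n + 1 := ⟨L - 1, by omega⟩
  have mid : ∀ k, 0 < k → k ≤ n →
      (pre u c (i + k) - pre u c i) - (pre u c (j + k) - pre u c j) = 1 := by
    intro k h1 h2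
    have p1 := hmin k (by omega) i j
    have p2 := hmin (n + 1 - k) (by omega) (i + k) (j + k)
    rw [show i + k + (n + 1 - k) = i + (n + 1) by omega,
      show j + k + (n + 1 - k) = j + (n + 1) by omega] at p2
    omega
  have hf := mid 1 (by omega) (by omega)
  have hl := mid n (by omega) (by omega)
  have E : (u i = c ∧ u j ≠ c) ∧ (u (i + n) = c ∧ u (j + n) ≠ c) ∧
      pre u c (i + 1) = pre u c i + 1 ∧ pre u c (j + 1) = pre u c j ∧
      pre u c (i + (n + 1)) = pre u c (i + n) + 1 ∧
      pre u c (j + (n + 1)) = pre u c (j + n) := by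
    have a1 := st i
    have a2 := st j
    have a3 := st (i + n)
    have a4 := st (j + n)
    rw [Nat.add_assoc] at a3 a4
    refine ⟨⟨?_, ?_⟩, ⟨?_, ?_⟩, ?_⟩
    · rcases a1 with a1 | a1
      · exact a1.2
      · exfalso; omega
    · rcases a2 with a2 | a2
      · exfalso; omega
      · exact a2.2
    · rcases a3 with a3 | a3
      · exact a3.2
      · exfalso; omega
    · rcases a4 with a4 | a4
      · exfalso; omega
      · exact a4.2
    · omega
  obtain ⟨⟨E1, E2⟩, ⟨E3, E4⟩, E5, E6, E7, E8⟩ := E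
  refine ⟨n, i, j, by omega, by rw [E1, E3], two _ _ E2 E4, by rw [E1]; exact E2.symm, ?_, ?_⟩
  · intro k h1 h2
    have p1 := mid k h1 (by omega)
    have p2 := mid (k + 1) (by omega) (by omega)
    refine eqof _ _ ?_
    rw [Nat.add_assoc, Nat.add_assoc]
    omega
  · have sym : ∀ k, k < n → pre u c (i + (k + 1)) - pre u c (i + 1) =
        pre u c (i + n) - pre u c (i + (n - k)) := by
      intro k hk
      have p1 := hmin (k + 1) (by omega) i (j + (n - k))
      have p2 := hmin (k + 1) (by omega) (i + (n - k)) j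
      rw [show j + (n - k) + (k + 1) = j + (n + 1) by omega] at p1
      rw [show i + (n - k) + (k + 1) = i + (n + 1) by omega] at p2
      have p3 := mid (n - k) (by omega) (by omega)
      have p4 := mid (k + 1) (by omega) (by omega)
      omega
    intro k h1 h2
    have s1 := sym k h2
    have s2 := sym (k - 1) (by omega)
    rw [show k - 1 + 1 = k by omega, show n - (k - 1) = n - k + 1 by omega] at s2
    refine eqof _ _ ?_
    rw [Nat.add_assoc, Nat.add_assoc]
    omega

theorem sturm_core {A : Type*} [Fintype A] (u : ℕ → A) (n i j : ℕ)
    (hc : complexity u n = n + 1) (hu : UniqSpecial u n) (hap : Aperiodic u)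
    (hi : u i = u (i + n)) (hj : u j = u (j + n)) (hij : u i ≠ u j) (hn : 1 ≤ n)
    (heq : ∀ k, 0 < k → k < n → u (i + k) = u (j + k))
    (hpal : ∀ k, 0 < k → k < n → u (i + k) = u (i + (n - k)))
    (s t : ℕ) (hst : word u s n = word u t n) (hd : u (s + n) ≠ u (t + n))
    (hs : word u s n = word u i n) : False := by
  have hno : ∀ p, p ≤ n → word u (j + p) n ≠ word u i n := by
    intro p hp e
    rw [wd_eq] at e
    have e0 := e 0 (by omega)
    simp only [Nat.add_zero] at e0
    rcases Nat.eq_zero_or_pos p with rfl | hp0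
    · exact hij e0.symm
    rcases Nat.lt_or_eq_of_le hp with hp1 | rfl
    · have e1 := e (n - p) (by omega)
      rw [show j + p + (n - p) = j + n by omega, ← hj, ← hpal p hp0 hp1, heq p hp0 hp1, e0] at e1
      exact hij e1.symm
    · rw [← hj] at e0
      exact hij e0.symm
  have hf := fin_range u n
  have hcard : (Set.range (fun i => word u i n) \ {word u i n}).ncard = n := by
    have := Set.ncard_diff_singleton_add_one
      (s := Set.range (fun i => word u i n)) (a := word u i n) ⟨i, rfl⟩ hf
    rw [← cx_eq, hc] at this
    omega
  have hrep : ∃ p q, p < q ∧ q ≤ n ∧ word u (j + p) n = word u (j + q) n := by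
    by_contra! hcon
    have hle : (Set.Iio (n + 1)).ncard ≤ (Set.range (fun i => word u i n) \ {word u i n}).ncard := by
      refine Set.ncard_le_ncard_of_injOn (fun p => word u (j + p) n) ?_ ?_ hf.diff
      · intro p hp
        exact ⟨⟨j + p, rfl⟩, hno p (Nat.lt_succ_iff.1 hp)⟩
      · intro p hp q hq e
        simp only [Set.mem_Iio] at hp hq
        by_contra hne
        rcases lt_or_gt_of_ne hne with h | h
        · exact hcon p q h (by omega) e
        · exact hcon q p h (by omega) e.symm
    rw [hcard, Set.ncard_eq_toFinset_card'] at hle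
    simp at hle
  obtain ⟨p, q, hpq, hq, e⟩ := hrep
  refine hap (periodic_of_rep u n (j + p) (j + q) (by omega) e ?_)
  intro x h1 h2 y hxy
  by_contra hne
  have := hu x y s t hxy hne hst hd
  refine hno (x - j) (by omega) ?_
  rw [show j + (x - j) = x by omega, this, hs]

/-- A binary infinite word is Sturmian iff it is aperiodic and
balanced. -/
theorem stmt10 {A : Type*} [Fintype A] [DecidableEq A] (u : ℕ → A)
    (hcard : Fintype.card A = 2)
    (hall : AllLettersOccur u) :
    (∀ n : ℕ, complexity u n = n + 1) ↔ Aperiodic u ∧ IsBalanced u := by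
  obtain ⟨a, b, hne, huniv⟩ := Nat.card_eq_two_iff.1 (Nat.card_eq_fintype_card.trans hcard)
  have hab : ∀ x, x = a ∨ x = b := by
    intro x
    have : x ∈ ({a, b} : Set A) := huniv ▸ Set.mem_univ x
    simpa using this
  constructor
  · intro hC
    have hap : Aperiodic u := by
      intro hp
      obtain ⟨M, hM⟩ := cx_le_of_periodic u hp
      have := hM M
      rw [hC] at this
      omega
    refine ⟨hap, ?_⟩
    by_contra hb
    obtain ⟨n, i, j, hn, hi, hj, hij, heq, hpal⟩ := unbal u a b hab hb
    have huq : ∀ m, UniqSpecial u m := fun m => uniq_of_cx u m (by rw [hC, hC])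
    obtain ⟨s, t, hst, hd⟩ := exists_special u hap n
    obtain ⟨m, rfl⟩ : ∃ m, n = m + 1 := ⟨n - 1, by omega⟩
    have hw : word u (s + 1) m = word u (i + 1) m := by
      refine huq m (s + 1) (t + 1) (i + 1) (j + 1) ?_ ?_ ?_ ?_
      · rw [wd_eq] at hst ⊢
        intro k hk
        have := hst (k + 1) (by omega)
        rwa [Nat.add_assoc, Nat.add_assoc, Nat.add_comm 1 k]
      · rwa [Nat.add_assoc, Nat.add_assoc, Nat.add_comm 1 m]
      · rw [wd_eq]
        intro k hk
        have := heq (k + 1) (by omega) (by omega)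
        rwa [Nat.add_assoc, Nat.add_assoc, Nat.add_comm 1 k]
      · rwa [Nat.add_assoc, Nat.add_assoc, Nat.add_comm 1 m, ← hi, ← hj]
    rw [wd_eq] at hw
    have hor : u s = u i ∨ u s = u j := by
      rcases hab (u s) with h1 | h1 <;> rcases hab (u i) with h2 | h2 <;>
        rcases hab (u j) with h3 | h3 <;> simp_all
    rcases hor with h | h
    · refine sturm_core u (m + 1) i j (hC _) (huq _) hap hi hj hij hn heq hpal s t hst hd ?_
      rw [wd_eq]
      intro k hk
      rcases k with _ | k
      · exact h
      · have := hw k (by omega)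
        rwa [Nat.add_assoc, Nat.add_assoc, Nat.add_comm 1 k] at this
    · refine sturm_core u (m + 1) j i (hC _) (huq _) hap hj hi hij.symm hn
        (fun k h1 h2 => (heq k h1 h2).symm) ?_ s t hst hd ?_
      · intro k h1 h2
        rw [← heq k h1 h2, ← heq (m + 1 - k) (by omega) (by omega)]
        exact hpal k h1 h2
      rw [wd_eq]
      intro k hk
      rcases k with _ | k
      · exact h
      · have := hw k (by omega)
        rw [Nat.add_assoc, Nat.add_assoc, Nat.add_comm 1 k] at this
        rw [this]
        exact heq (k + 1) (by omega) hk
  · rintro ⟨hap, hb⟩ n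
    induction n with
    | zero => exact cx_zero u
    | succ n ih =>
      have h1 := cx_lt u hap n
      have h2 := cx_of_uniq u n a b hab (uniq_of_bal u a b hab hne hb n)
      omega
end
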